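/- There exists a finite set S ⊆ ℤ × ℤ × ℤ with exactly 7 elements such that, letting P ⊆ ℝ³ be the union over v ∈ S of the translated unit cubes v + [0,1]³, the following holds: for every real number L there exists a simple closed curve γ contained in frontier P of length exceeding L that is a strong geodesic, i.e., γ : ℝ → ℝ³ is continuous, periodic with period 1, injective on [0,1), has image in frontier P, and for every t ∈ ℝ there is ε > 0 so that for all s₁ ≤ s₂ in (t−ε, t+ε), every continuous path with image in ℝ³ \ interior P joining γ s₁ to γ s₂ has length (total variation over its parameter interval) at least eVariationOn γ (Set.Icc s₁ s₂). (A non-convex polyhedron, a union of seven equal cubes, admits arbitrarily long simple closed strong geodesics.) -/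

import Mathlib

/-- The axis-parallel unit cube `v + [0,1]³` in `ℝ³`, for `v ∈ ℤ × ℤ × ℤ`. -/
def unitCube (v : ℤ × ℤ × ℤ) : Set (EuclideanSpace ℝ (Fin 3)) :=
  {x | x 0 ∈ Set.Icc (v.1 : ℝ) ((v.1 : ℝ) + 1) ∧
       x 1 ∈ Set.Icc (v.2.1 : ℝ) ((v.2.1 : ℝ) + 1) ∧
       x 2 ∈ Set.Icc (v.2.2 : ℝ) ((v.2.2 : ℝ) + 1)}

section Variation
variable {E : Type*} [NormedAddCommGroup E]

lemma eVariationOn_le_of_norm_sub_le {γ : ℝ → E} {ℓ a b : ℝ} (hℓ : 0 ≤ ℓ)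
    (h : ∀ s ∈ Set.Icc a b, ∀ t ∈ Set.Icc a b, ‖γ s - γ t‖ ≤ ℓ * |s - t|) (hab : a ≤ b) :
    eVariationOn γ (Set.Icc a b) ≤ ENNReal.ofReal (ℓ * (b - a)) := by
  have hL : LipschitzOnWith ℓ.toNNReal γ (Set.Icc a b) :=
    LipschitzOnWith.of_dist_le_mul fun s hs t ht => by
      rw [dist_eq_norm, Real.dist_eq, Real.coe_toNNReal _ hℓ]
      exact h s hs t ht
  have h₁ := hL.comp_eVariationOn_le (g := id) (s := Set.Icc a b) (fun _ h => h)
  refine h₁.trans ?_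
  rw [ENNReal.ofReal_mul hℓ]
  refine mul_le_mul le_rfl ?_ zero_le zero_le
  have := (monotone_id.monotoneOn (Set.Icc a b)).eVariationOn_eq
    (Set.left_mem_Icc.2 hab) (Set.right_mem_Icc.2 hab)
  rw [Set.inter_self] at this
  exact this.le

lemma eVariationOn_Icc_add_Icc (γ : ℝ → E) {a b c : ℝ} (hab : a ≤ b) (hbc : b ≤ c) :
    eVariationOn γ (Set.Icc a b) + eVariationOn γ (Set.Icc b c) = eVariationOn γ (Set.Icc a c) := by
  simpa using eVariationOn.Icc_add_Icc (s := Set.univ) γ hab hbc (Set.mem_univ _)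

lemma edist_add_edist_le_eVariationOn (c : ℝ → E) {a b t : ℝ} (ht : t ∈ Set.Icc a b) :
    edist (c a) (c t) + edist (c t) (c b) ≤ eVariationOn c (Set.Icc a b) := by
  rw [← eVariationOn_Icc_add_Icc c ht.1 ht.2]
  exact add_le_add
    (eVariationOn.edist_le c (Set.left_mem_Icc.2 ht.1) (Set.right_mem_Icc.2 ht.1))
    (eVariationOn.edist_le c (Set.left_mem_Icc.2 ht.2) (Set.right_mem_Icc.2 ht.2))

lemma exists_mem_inter_of_isClosed {c : ℝ → E} {a b : ℝ} (hab : a ≤ b)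
    (hc : ContinuousOn c (Set.Icc a b)) {K₁ K₂ : Set E} (hK₁ : IsClosed K₁) (hK₂ : IsClosed K₂)
    (h : ∀ t ∈ Set.Icc a b, c t ∈ K₁ ∪ K₂) (ha : c a ∈ K₁) (hb : c b ∈ K₂) :
    ∃ t ∈ Set.Icc a b, c t ∈ K₁ ∩ K₂ := by
  have hI : IsPreconnected (c '' Set.Icc a b) := isPreconnected_Icc.image c hc
  obtain ⟨-, ⟨t, ht, rfl⟩, hx⟩ := isPreconnected_closed_iff.1 hI K₁ K₂ hK₁ hK₂
    (by rintro - ⟨t, ht, rfl⟩; exact h t ht)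
    ⟨c a, ⟨a, Set.left_mem_Icc.2 hab, rfl⟩, ha⟩ ⟨c b, ⟨b, Set.right_mem_Icc.2 hab, rfl⟩, hb⟩
  exact ⟨t, ht, hx⟩

lemma eVariationOn_comp_natCast_mul (γ : ℝ → E) (n : ℕ) :
    eVariationOn (fun t => γ (n * t)) (Set.Icc 0 1) = eVariationOn γ (Set.Icc 0 n) := by
  have h : (fun t : ℝ => (n : ℝ) * t) '' Set.Icc 0 1 = Set.Icc 0 (n : ℝ) := by
    rw [Set.image_mul_left_Icc n.cast_nonneg zero_le_one, mul_zero, mul_one]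
  rw [← h]
  exact eVariationOn.comp_eq_of_monotoneOn γ _
    fun _ _ _ _ hst => mul_le_mul_of_nonneg_left hst n.cast_nonneg

end Variation

/-- The polygonal line through the points `p k`, visiting `p k` at the integer time `k`. -/
noncomputable def polygonal {E : Type*} [AddCommGroup E] [Module ℝ E] (p : ℤ → E) (t : ℝ) : E :=
  p ⌊t⌋ + Int.fract t • (p (⌊t⌋ + 1) - p ⌊t⌋)

section Polygonal
variable {E : Type*} [NormedAddCommGroup E] [NormedSpace ℝ E]

lemma polygonal_of_mem_Icc (p : ℤ → E) {k : ℤ} {t : ℝ} (ht : t ∈ Set.Icc (k : ℝ) (k + 1)) :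
    polygonal p t = p k + (t - k) • (p (k + 1) - p k) := by
  rcases ht.2.eq_or_lt with h | h
  · subst h
    have : ⌊(k : ℝ) + 1⌋ = k + 1 := by simp
    simp [polygonal, this]
  · have : ⌊t⌋ = k := Int.floor_eq_iff.2 ⟨ht.1, h⟩
    simp [polygonal, Int.fract, this]

lemma polygonal_intCast (p : ℤ → E) (k : ℤ) : polygonal p k = p k := by
  simp [polygonal]

lemma polygonal_add_intCast {p : ℤ → E} {n : ℤ} (hp : Function.Periodic p n) (t : ℝ) :
    polygonal p (t + n) = polygonal p t := by
  have h : ⌊t⌋ + n + 1 = ⌊t⌋ + 1 + n := by ring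
  simp [polygonal, h, hp _]

/-- Near `t₀` the curve `γ` arrives at `γ t₀` with velocity `d₁` and leaves with velocity `d₂`. -/
def HasVelocities (γ : ℝ → E) (t₀ : ℝ) (d₁ d₂ : E) : Prop :=
  ∃ η > 0, (∀ t ∈ Set.Icc (t₀ - η) t₀, γ t = γ t₀ - (t₀ - t) • d₁) ∧
    ∀ t ∈ Set.Icc t₀ (t₀ + η), γ t = γ t₀ + (t - t₀) • d₂

lemma HasVelocities.comp_mul {γ : ℝ → E} {d₁ d₂ : E} {n t₀ : ℝ} (hn : 0 < n)
    (h : HasVelocities γ (n * t₀) d₁ d₂) :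
    HasVelocities (fun t => γ (n * t)) t₀ (n • d₁) (n • d₂) := by
  obtain ⟨η, hη, h₁, h₂⟩ := h
  have e : n * (η / n) = η := by field_simp
  refine ⟨η / n, by positivity, fun t ht => ?_, fun t ht => ?_⟩
  · rw [smul_smul]
    convert h₁ (n * t) ⟨?_, ?_⟩ using 3
    · ring
    · nlinarith [ht.1, ht.2]
    · nlinarith [ht.1, ht.2]
  · rw [smul_smul]
    convert h₂ (n * t) ⟨?_, ?_⟩ using 3
    · ring
    · nlinarith [ht.1, ht.2]
    · nlinarith [ht.1, ht.2]

lemma HasVelocities.continuousAt {γ : ℝ → E} {d₁ d₂ : E} {t₀ : ℝ}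
    (h : HasVelocities γ t₀ d₁ d₂) : ContinuousAt γ t₀ := by
  obtain ⟨η, hη, h₁, h₂⟩ := h
  rw [continuousAt_iff_continuous_left_right]
  constructor
  · have : ContinuousWithinAt (fun t => γ t₀ - (t₀ - t) • d₁) (Set.Iic t₀) t₀ := by fun_prop
    refine this.congr_of_eventuallyEq ?_ (by simp)
    filter_upwards [self_mem_nhdsWithin,
      mem_nhdsWithin_of_mem_nhds (Ici_mem_nhds (sub_lt_self t₀ hη))]
      with t ht ht' using h₁ t ⟨ht', ht⟩
  · have : ContinuousWithinAt (fun t => γ t₀ + (t - t₀) • d₂) (Set.Ici t₀) t₀ := by fun_prop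
    refine this.congr_of_eventuallyEq ?_ (by simp)
    filter_upwards [self_mem_nhdsWithin,
      mem_nhdsWithin_of_mem_nhds (Iic_mem_nhds (lt_add_of_pos_right t₀ hη))]
      with t ht ht' using h₂ t ⟨ht, ht'⟩

lemma hasVelocities_polygonal_intCast (p : ℤ → E) (k : ℤ) :
    HasVelocities (polygonal p) k (p k - p (k - 1)) (p (k + 1) - p k) := by
  refine ⟨1, one_pos, fun t ht => ?_, fun t ht => ?_⟩
  · rw [polygonal_intCast, polygonal_of_mem_Icc p (k := k - 1)
      ⟨by push_cast; linarith [ht.1], by push_cast; linarith [ht.2]⟩]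
    push_cast
    rw [sub_add_cancel]
    module
  · rw [polygonal_intCast, polygonal_of_mem_Icc p ht]

lemma hasVelocities_polygonal (p : ℤ → E) {k : ℤ} {t : ℝ} (ht : t ∈ Set.Ioo (k : ℝ) (k + 1)) :
    HasVelocities (polygonal p) t (p (k + 1) - p k) (p (k + 1) - p k) := by
  refine ⟨min (t - k) (k + 1 - t), lt_min (by linarith [ht.1]) (by linarith [ht.2]),
    fun s hs => ?_, fun s hs => ?_⟩ <;>
  · have h₁ := min_le_left (t - k) (k + 1 - t)
    have h₂ := min_le_right (t - k) (k + 1 - t)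
    rw [polygonal_of_mem_Icc p ⟨ht.1.le, ht.2.le⟩,
      polygonal_of_mem_Icc p (k := k) ⟨by linarith [hs.1, hs.2, ht.1], by linarith [hs.1, hs.2, ht.2]⟩]
    module

lemma continuous_polygonal (p : ℤ → E) : Continuous (polygonal p) := by
  refine continuous_iff_continuousAt.2 fun t => ?_
  rcases (Int.floor_le t).eq_or_lt with h | h
  · rw [← h]
    exact (hasVelocities_polygonal_intCast p _).continuousAt
  · exact (hasVelocities_polygonal p ⟨h, Int.lt_floor_add_one t⟩).continuousAt

lemma eVariationOn_polygonal_ne_top (p : ℤ → E) (n : ℕ) :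
    eVariationOn (polygonal p) (Set.Icc 0 n) ≠ ⊤ := by
  induction n with
  | zero => simp
  | succ n ih =>
    rw [← eVariationOn_Icc_add_Icc _ n.cast_nonneg (Nat.cast_le.2 n.le_succ)]
    refine ENNReal.add_ne_top.2 ⟨ih, ne_top_of_le_ne_top ENNReal.ofReal_ne_top
      (eVariationOn_le_of_norm_sub_le (norm_nonneg (p (n + 1) - p n)) (fun s hs t ht => ?_)
        (Nat.cast_le.2 n.le_succ))⟩
    push_cast at hs ht
    rw [polygonal_of_mem_Icc p (k := n) (by exact_mod_cast hs),
      polygonal_of_mem_Icc p (k := n) (by exact_mod_cast ht), add_sub_add_left_eq_sub, ← sub_smul,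
      norm_smul, mul_comm, sub_sub_sub_cancel_right, Real.norm_eq_abs]

lemma ofReal_le_eVariationOn_polygonal {p : ℤ → E} {ℓ : ℝ} (hℓ : 0 ≤ ℓ) (h : ∀ k, ℓ ≤ ‖p (k + 1) - p k‖) (n : ℕ) :
    ENNReal.ofReal (n * ℓ) ≤ eVariationOn (polygonal p) (Set.Icc 0 n) := by
  induction n with
  | zero => simp
  | succ n ih =>
    have hn : (n : ℝ) ≤ (n + 1 : ℕ) := Nat.cast_le.2 n.le_succ
    rw [← eVariationOn_Icc_add_Icc _ n.cast_nonneg hn, Nat.cast_succ, add_one_mul,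
      ENNReal.ofReal_add (by positivity) hℓ]
    refine add_le_add ih (le_trans ?_ (eVariationOn.edist_le (polygonal p)
      (Set.right_mem_Icc.2 (by simp)) (Set.left_mem_Icc.2 (by simp))))
    have e1 := polygonal_intCast p n
    have e2 := polygonal_intCast p (n + 1)
    push_cast at e1 e2
    rw [e1, e2, edist_dist, dist_eq_norm]
    exact ENNReal.ofReal_le_ofReal (h n)

lemma polygonal_neg (p : ℤ → E) (t : ℝ) :
    polygonal p (-t) = polygonal (fun k => p (-k)) t := by
  have h0 := Int.floor_le t
  have h1 := (Int.lt_floor_add_one t).le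
  rw [polygonal_of_mem_Icc p (k := -⌊t⌋ - 1)
    ⟨by push_cast; linarith, by push_cast; linarith⟩, polygonal_of_mem_Icc _ ⟨h0, h1⟩]
  rw [neg_add', sub_add_cancel]
  push_cast
  module

lemma polygonal_mem {p : ℤ → E} {s : Set E}
    (hs : Convex ℝ s) {t : ℝ} (h : ∀ i ∈ ({⌊t⌋, ⌊t⌋ + 1} : Set ℤ), p i ∈ s) : polygonal p t ∈ s :=
  hs.add_smul_sub_mem (h _ (by simp)) (h _ (by simp)) ⟨Int.fract_nonneg t, (Int.fract_lt_one t).le⟩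

end Polygonal

section ShortestBend

variable {E : Type*} [NormedAddCommGroup E] [InnerProductSpace ℝ E]

open scoped RealInnerProductSpace

/-- At `p` a broken line with directions `d₁`, `d₂` is locally shortest outside the solid `P`:
near `p` the exterior of `P` is covered by two closed sets, one containing the arriving ray and
the other the leaving one, such that crossing from one to the other is no shortcut. -/
def IsShortestBend (P : Set E) (p d₁ d₂ : E) : Prop :=
  ‖d₁‖ = ‖d₂‖ ∧ ∃ r > 0, ∃ K₁ K₂ : Set E, IsClosed K₁ ∧ IsClosed K₂ ∧
    (∀ x ∈ Metric.ball p r, x ∉ interior P → x ∈ K₁ ∪ K₂) ∧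
    (∀ s : ℝ, 0 ≤ s → p - s • d₁ ∈ K₁) ∧ (∀ s : ℝ, 0 ≤ s → p + s • d₂ ∈ K₂) ∧
    ∀ m ∈ K₁ ∩ K₂, 0 ≤ ⟪m - p, d₁ - d₂⟫

lemma isShortestBend_self (P : Set E) (p d : E) : IsShortestBend P p d d :=
  ⟨rfl, 1, one_pos, Set.univ, Set.univ, isClosed_univ, isClosed_univ, by simp, by simp, by simp,
    by simp⟩

lemma IsShortestBend.smul {P : Set E} {p d₁ d₂ : E} (h : IsShortestBend P p d₁ d₂) {n : ℝ}
    (hn : 0 ≤ n) : IsShortestBend P p (n • d₁) (n • d₂) := by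
  obtain ⟨hd, r, hr, K₁, K₂, hK₁, hK₂, hP, h₁, h₂, hm⟩ := h
  refine ⟨by rw [norm_smul, norm_smul, hd], r, hr, K₁, K₂, hK₁, hK₂, hP, fun s hs => ?_,
    fun s hs => ?_, fun m hmK => ?_⟩
  · rw [smul_smul]
    exact h₁ _ (by positivity)
  · rw [smul_smul]
    exact h₂ _ (by positivity)
  · rw [← smul_sub, inner_smul_right]
    exact mul_nonneg hn (hm m hmK)

lemma add_mul_norm_le_of_inner_nonneg {p d₁ d₂ m : E} (hd : ‖d₁‖ = ‖d₂‖)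
    (hm : 0 ≤ ⟪m - p, d₁ - d₂⟫) (s t : ℝ) :
    (s + t) * ‖d₁‖ ≤ ‖p - s • d₁ - m‖ + ‖m - (p + t • d₂)‖ := by
  rcases (norm_nonneg d₁).eq_or_lt with h0 | h0
  · rw [← h0, mul_zero]
    positivity
  have h₁ := real_inner_le_norm (m - (p - s • d₁)) d₁
  have h₂ := real_inner_le_norm (p + t • d₂ - m) d₂
  rw [norm_sub_rev (p - s • d₁) m, norm_sub_rev m (p + t • d₂)]
  rw [← hd] at h₂
  have e : ⟪m - (p - s • d₁), d₁⟫ + ⟪p + t • d₂ - m, d₂⟫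
      = ⟪m - p, d₁ - d₂⟫ + (s + t) * ‖d₁‖ * ‖d₁‖ := by
    simp only [inner_add_left, inner_sub_left, inner_sub_right, inner_smul_left,
      real_inner_self_eq_norm_mul_norm, ← hd, conj_trivial]
    ring
  refine le_of_mul_le_mul_right ?_ h0
  linarith

theorem IsShortestBend.locally_shortest {P : Set E} {γ : ℝ → E} {t₀ : ℝ} {d₁ d₂ : E}
    (h : IsShortestBend P (γ t₀) d₁ d₂) (hγ : HasVelocities γ t₀ d₁ d₂) :
    ∃ ε > (0 : ℝ), ∀ s₁ s₂ : ℝ, s₁ ∈ Set.Ioo (t₀ - ε) (t₀ + ε) → s₂ ∈ Set.Ioo (t₀ - ε) (t₀ + ε) →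
      s₁ ≤ s₂ → ∀ (a b : ℝ) (c : ℝ → E), a ≤ b → ContinuousOn c (Set.Icc a b) →
        c a = γ s₁ → c b = γ s₂ → (∀ x ∈ Set.Icc a b, c x ∉ interior P) →
        eVariationOn γ (Set.Icc s₁ s₂) ≤ eVariationOn c (Set.Icc a b) := by
  obtain ⟨η, hη, hl, hr⟩ := hγ
  obtain ⟨hd, r, hr0, K₁, K₂, hK₁, hK₂, hP, h₁, h₂, hm⟩ := h
  have hℓ := norm_nonneg d₁
  set ℓ := ‖d₁‖ with hℓd
  have hlip : ∀ s ∈ Set.Icc (t₀ - η) (t₀ + η), ∀ t ∈ Set.Icc (t₀ - η) (t₀ + η),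
      ‖γ s - γ t‖ ≤ ℓ * |s - t| := by
    have key : ∀ s ∈ Set.Icc (t₀ - η) (t₀ + η), ∀ t ∈ Set.Icc (t₀ - η) (t₀ + η), s ≤ t →
        ‖γ s - γ t‖ ≤ ℓ * |s - t| := by
      intro s hs t ht hst
      rw [abs_sub_comm, abs_of_nonneg (sub_nonneg.2 hst)]
      rcases le_total t t₀ with htt | htt
      · rw [hl s ⟨hs.1, hst.trans htt⟩, hl t ⟨ht.1, htt⟩]
        rw [show γ t₀ - (t₀ - s) • d₁ - (γ t₀ - (t₀ - t) • d₁) = -((t - s) • d₁) by module,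
          norm_neg, norm_smul, Real.norm_eq_abs, abs_of_nonneg (sub_nonneg.2 hst), mul_comm]
      rcases le_total s t₀ with hss | hss
      · rw [hl s ⟨hs.1, hss⟩, hr t ⟨htt, ht.2⟩]
        rw [show γ t₀ - (t₀ - s) • d₁ - (γ t₀ + (t - t₀) • d₂)
          = -((t₀ - s) • d₁) - (t - t₀) • d₂ by module]
        refine (norm_sub_le _ _).trans ?_
        rw [norm_neg, norm_smul, norm_smul, Real.norm_eq_abs, Real.norm_eq_abs, ← hd,
          abs_of_nonneg (sub_nonneg.2 hss), abs_of_nonneg (sub_nonneg.2 htt)]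
        apply le_of_eq
        ring
      · rw [hr s ⟨hss, hs.2⟩, hr t ⟨htt, ht.2⟩]
        rw [show γ t₀ + (s - t₀) • d₂ - (γ t₀ + (t - t₀) • d₂) = -((t - s) • d₂) by module,
          norm_neg, norm_smul, Real.norm_eq_abs, abs_of_nonneg (sub_nonneg.2 hst), mul_comm, ← hd]
    intro s hs t ht
    rcases le_total s t with hst | hst
    · exact key s hs t ht hst
    · rw [norm_sub_rev, abs_sub_comm]
      exact key t ht s hs hst
  refine ⟨min η (r / (2 * (ℓ + 1))), by positivity, fun s₁ s₂ hs₁ hs₂ hs a b c hab hc ha hb hcP => ?_⟩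
  have hε₁ := min_le_left η (r / (2 * (ℓ + 1)))
  have hε₂ := min_le_right η (r / (2 * (ℓ + 1)))
  have hε₀ : 0 < min η (r / (2 * (ℓ + 1))) := by positivity
  set ε := min η (r / (2 * (ℓ + 1)))
  have hεr : 2 * (ℓ * ε) ≤ r := by
    rw [le_div_iff₀ (by positivity)] at hε₂
    nlinarith
  have hs₁' : s₁ ∈ Set.Icc (t₀ - η) (t₀ + η) := ⟨by linarith [hs₁.1], by linarith [hs₁.2]⟩
  have hs₂' : s₂ ∈ Set.Icc (t₀ - η) (t₀ + η) := ⟨by linarith [hs₂.1], by linarith [hs₂.2]⟩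
  have ht₀' : t₀ ∈ Set.Icc (t₀ - η) (t₀ + η) := ⟨by linarith, by linarith⟩
  refine (eVariationOn_le_of_norm_sub_le hℓ (fun s h t h' => hlip s ⟨hs₁'.1.trans h.1, h.2.trans hs₂'.2⟩
    t ⟨hs₁'.1.trans h'.1, h'.2.trans hs₂'.2⟩) hs).trans ?_
  have of_mem : ∀ t ∈ Set.Icc a b, ℓ * (s₂ - s₁) ≤ ‖γ s₁ - c t‖ + ‖c t - γ s₂‖ →
      ENNReal.ofReal (ℓ * (s₂ - s₁)) ≤ eVariationOn c (Set.Icc a b) := by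
    intro t ht h
    refine le_trans ?_ (edist_add_edist_le_eVariationOn c ht)
    rw [ha, hb, edist_dist, edist_dist, ← ENNReal.ofReal_add dist_nonneg dist_nonneg]
    apply ENNReal.ofReal_le_ofReal
    rwa [dist_eq_norm, dist_eq_norm]
  rcases le_total s₂ t₀ with h2 | h2
  · refine of_mem b (Set.right_mem_Icc.2 hab) ?_
    rw [hb, hl s₁ ⟨hs₁'.1, hs.trans h2⟩, hl s₂ ⟨hs₂'.1, h2⟩, sub_self, norm_zero, add_zero]
    rw [show γ t₀ - (t₀ - s₁) • d₁ - (γ t₀ - (t₀ - s₂) • d₁) = -((s₂ - s₁) • d₁) by module,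
      norm_neg, norm_smul, Real.norm_eq_abs, abs_of_nonneg (sub_nonneg.2 hs), mul_comm]
  rcases le_total t₀ s₁ with h1 | h1
  · refine of_mem b (Set.right_mem_Icc.2 hab) ?_
    rw [hb, hr s₁ ⟨h1, hs₁'.2⟩, hr s₂ ⟨h2, hs₂'.2⟩, sub_self, norm_zero, add_zero]
    rw [show γ t₀ + (s₁ - t₀) • d₂ - (γ t₀ + (s₂ - t₀) • d₂) = -((s₂ - s₁) • d₂) by module,
      norm_neg, norm_smul, Real.norm_eq_abs, abs_of_nonneg (sub_nonneg.2 hs), mul_comm, ← hd]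
  by_cases hball : ∀ t ∈ Set.Icc a b, c t ∈ Metric.ball (γ t₀) r
  · obtain ⟨t, ht, hmt⟩ := exists_mem_inter_of_isClosed hab hc hK₁ hK₂
      (fun t ht => hP _ (hball t ht) (hcP t ht))
      (by rw [ha, hl s₁ ⟨hs₁'.1, h1⟩]; exact h₁ _ (sub_nonneg.2 h1))
      (by rw [hb, hr s₂ ⟨h2, hs₂'.2⟩]; exact h₂ _ (sub_nonneg.2 h2))
    refine of_mem t ht ?_
    rw [hl s₁ ⟨hs₁'.1, h1⟩, hr s₂ ⟨h2, hs₂'.2⟩]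
    have := add_mul_norm_le_of_inner_nonneg hd (hm _ hmt) (t₀ - s₁) (s₂ - t₀)
    linarith
  · push Not at hball
    obtain ⟨t, ht, hmt⟩ := hball
    refine of_mem t ht ?_
    rw [Metric.mem_ball, not_lt, dist_eq_norm] at hmt
    have e₁ := hlip _ ht₀' _ hs₁'
    have e₂ := hlip _ ht₀' _ hs₂'
    rw [abs_of_nonneg (sub_nonneg.2 h1)] at e₁
    rw [abs_of_nonpos (sub_nonpos.2 h2)] at e₂
    have f₁ := norm_add_le (γ t₀ - γ s₁) (γ s₁ - c t)
    have f₂ := norm_add_le (c t - γ s₂) (γ s₂ - γ t₀)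
    rw [sub_add_sub_cancel, norm_sub_rev _ (c t)] at f₁
    rw [sub_add_sub_cancel, norm_sub_rev (γ s₂)] at f₂
    have g₁ : ℓ * (t₀ - s₁) ≤ ℓ * ε := mul_le_mul_of_nonneg_left (by linarith [hs₁.1]) hℓ
    have g₂ : ℓ * (s₂ - t₀) ≤ ℓ * ε := mul_le_mul_of_nonneg_left (by linarith [hs₂.2]) hℓ
    nlinarith

end ShortestBend

section Cubes

open scoped RealInnerProductSpace

/-- The lower corner of the unit cube `v + [0,1]³`. -/
def corner (v : ℤ × ℤ × ℤ) : Fin 3 → ℝ := ![(v.1 : ℝ), (v.2.1 : ℝ), (v.2.2 : ℝ)]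

lemma mem_unitCube_iff {v : ℤ × ℤ × ℤ} {x : EuclideanSpace ℝ (Fin 3)} :
    x ∈ unitCube v ↔ ∀ l, x l ∈ Set.Icc (corner v l) (corner v l + 1) := by
  simp [unitCube, corner, Fin.forall_fin_succ]

lemma isClosed_unitCube (v : ℤ × ℤ × ℤ) : IsClosed (unitCube v) := by
  have : unitCube v = ⋂ l, (fun x : EuclideanSpace ℝ (Fin 3) => x l) ⁻¹'
      Set.Icc (corner v l) (corner v l + 1) := by
    ext x
    simp only [mem_unitCube_iff, Set.mem_iInter, Set.mem_preimage]
  rw [this]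
  exact isClosed_iInter fun l => isClosed_Icc.preimage (by fun_prop)

lemma convex_unitCube (v : ℤ × ℤ × ℤ) : Convex ℝ (unitCube v) := by
  intro x hx y hy a b ha hb hab
  rw [mem_unitCube_iff] at *
  intro l
  simpa using convex_Icc _ _ (hx l) (hy l) ha hb hab

/-- The open unit cube `v + (0,1)³`. -/
def openUnitCube (v : ℤ × ℤ × ℤ) : Set (EuclideanSpace ℝ (Fin 3)) :=
  {x | ∀ l, x l ∈ Set.Ioo (corner v l) (corner v l + 1)}

lemma isOpen_openUnitCube (v : ℤ × ℤ × ℤ) : IsOpen (openUnitCube v) := by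
  have : openUnitCube v = ⋂ l, (fun x : EuclideanSpace ℝ (Fin 3) => x l) ⁻¹'
      Set.Ioo (corner v l) (corner v l + 1) := by
    ext x
    simp [openUnitCube]
  rw [this]
  exact isOpen_iInter_of_finite fun l => isOpen_Ioo.preimage (by fun_prop)

lemma openUnitCube_subset_interior {S : Finset (ℤ × ℤ × ℤ)} {v : ℤ × ℤ × ℤ} (hv : v ∈ S) :
    openUnitCube v ⊆ interior (⋃ v ∈ S, unitCube v) :=
  interior_maximal (fun _ hx => Set.mem_biUnion hv
    (mem_unitCube_iff.2 fun l => Set.Ioo_subset_Icc_self (hx l))) (isOpen_openUnitCube v)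

lemma disjoint_openUnitCube_unitCube {v w : ℤ × ℤ × ℤ} {x : EuclideanSpace ℝ (Fin 3)}
    (hx : x ∈ openUnitCube v) (hx' : x ∈ unitCube w) : v = w := by
  have key : ∀ {m n : ℤ} {y : ℝ}, y ∈ Set.Ioo (m : ℝ) (m + 1) → y ∈ Set.Icc (n : ℝ) (n + 1) →
      m = n := by
    intro m n y h h'
    have h₁ : (m : ℝ) < n + 1 := h.1.trans_le h'.2
    have h₂ : (n : ℝ) < m + 1 := h'.1.trans_lt h.2
    norm_cast at h₁ h₂
    omega
  exact Prod.ext (key (hx 0) hx'.1) (Prod.ext (key (hx 1) hx'.2.1) (key (hx 2) hx'.2.2))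

lemma unitCube_subset_closure (v : ℤ × ℤ × ℤ) : unitCube v ⊆ closure (openUnitCube v) := by
  intro x hx
  rw [mem_unitCube_iff] at hx
  let z : EuclideanSpace ℝ (Fin 3) := WithLp.toLp 2 fun l => corner v l + 1 / 2
  have hc : ContinuousWithinAt (fun s : ℝ => x + s • (z - x)) (Set.Ioo 0 1) 0 := by fun_prop
  have hx0 := hc.mem_closure_image (by simp [closure_Ioo])
  simp only [zero_smul, add_zero] at hx0
  refine closure_mono ?_ hx0
  rintro - ⟨s, hs, rfl⟩ l
  have h := hx l
  have e : (x + s • (z - x)) l = x l + s * (corner v l + 1 / 2 - x l) := by simp [z]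
  rw [e]
  constructor <;> nlinarith [h.1, h.2, hs.1, hs.2]

lemma mem_frontier_of_mem_unitCube {S : Finset (ℤ × ℤ × ℤ)} {v w : ℤ × ℤ × ℤ} (hv : v ∈ S)
    (hw : w ∉ S) {x : EuclideanSpace ℝ (Fin 3)} (hxv : x ∈ unitCube v) (hxw : x ∈ unitCube w) :
    x ∈ frontier (⋃ v ∈ S, unitCube v) := by
  rw [frontier_eq_closure_inter_closure]
  refine ⟨subset_closure (Set.mem_biUnion hv hxv),
    closure_mono ?_ (unitCube_subset_closure w hxw)⟩
  intro y hy hy'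
  simp only [Set.mem_iUnion] at hy'
  obtain ⟨u, hu, hyu⟩ := hy'
  exact hw (disjoint_openUnitCube_unitCube hy hyu ▸ hu)

/-- A broken line that crosses a convex edge of a cube so that it is straight when the two faces
at this edge are unfolded is locally shortest. Here `i` and `j` are the axes normal to the
two faces, `k` is the axis of the edge, and `σ`, `τ` are the signs of the outer normals. -/
lemma isShortestBend_of_edge {S : Finset (ℤ × ℤ × ℤ)} {p d₁ d₂ : EuclideanSpace ℝ (Fin 3)}
    (v : ℤ × ℤ × ℤ) (i j k : Fin 3) (σ τ c : ℝ)
    (hc : 0 ≤ c) (hpi : p i = corner v i + (1 + σ) / 2) (hpj : p j = corner v j + (1 + τ) / 2)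
    (hpk : p k ∈ Set.Ioo (corner v k) (corner v k + 1))
    (h₁i : d₁ i = 0) (h₁j : d₁ j = τ * c) (h₂i : d₂ i = -σ * c) (h₂j : d₂ j = 0)
    (hk : d₁ k = d₂ k)
    (hv : v ∈ S := by decide) (hijk : ∀ l, l = i ∨ l = j ∨ l = k := by decide)
    (hij : i ≠ j := by decide) (hik : i ≠ k := by decide) (hjk : j ≠ k := by decide)
    (hσ : σ = 1 ∨ σ = -1 := by simp) (hτ : τ = 1 ∨ τ = -1 := by simp) :
    IsShortestBend (⋃ v ∈ S, unitCube v) p d₁ d₂ := by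
  have hu : (Finset.univ : Finset (Fin 3)) = {i, j, k} := by
    ext l
    simpa using hijk l
  have hsum : ∀ f : Fin 3 → ℝ, ∑ l, f l = f i + (f j + f k) := fun f => by
    rw [hu, Finset.sum_insert (by simp [hij, hik]), Finset.sum_pair hjk]
  have hσ2 : σ ^ 2 = 1 := by rcases hσ with rfl | rfl <;> norm_num
  have hτ2 : τ ^ 2 = 1 := by rcases hτ with rfl | rfl <;> norm_num
  refine ⟨?_, min 1 (min (p k - corner v k) (corner v k + 1 - p k)), ?_, {x | 0 ≤ σ * (x i - p i)},
    {x | 0 ≤ τ * (x j - p j)}, ?_, ?_, ?_, ?_, ?_, ?_⟩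
  · rw [EuclideanSpace.norm_eq, EuclideanSpace.norm_eq, hsum, hsum]
    simp only [Real.norm_eq_abs, sq_abs]
    rw [h₁i, h₁j, h₂i, h₂j, hk, mul_pow, mul_pow, neg_sq, hσ2, hτ2]
    congr 1
    ring
  · exact lt_min one_pos (lt_min (sub_pos.2 hpk.1) (sub_pos.2 hpk.2))
  · exact isClosed_le continuous_const (by fun_prop)
  · exact isClosed_le continuous_const (by fun_prop)
  · intro x hx hxP
    by_contra hcon
    simp only [Set.mem_union, Set.mem_ofPred_eq, not_or, not_le] at hcon
    refine hxP (openUnitCube_subset_interior hv fun l => ?_)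
    have hl : ∀ l, |x l - p l| < min 1 (min (p k - corner v k) (corner v k + 1 - p k)) := fun l => by
      refine lt_of_le_of_lt ?_ (mem_ball_iff_norm.1 hx)
      simpa using PiLp.norm_apply_le (x - p) l
    have h1 := fun l => abs_lt.1 ((hl l).trans_le (min_le_left _ _))
    rcases hijk l with rfl | rfl | rfl
    · have := h1 l
      rcases hσ with rfl | rfl <;> constructor <;> linarith [this.1, this.2, hcon.1]
    · have := h1 l
      rcases hτ with rfl | rfl <;> constructor <;> linarith [this.1, this.2, hcon.2]
    · have h2 := abs_lt.1 ((hl l).trans_le ((min_le_right _ _).trans (min_le_left _ _)))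
      have h3 := abs_lt.1 ((hl l).trans_le ((min_le_right _ _).trans (min_le_right _ _)))
      constructor <;> linarith [h2.1, h3.2]
  · intro s _
    simp [h₁i]
  · intro s _
    simp [h₂j]
  · rintro m ⟨hm₁, hm₂⟩
    rw [PiLp.inner_apply, hsum]
    simp only [PiLp.sub_apply, RCLike.inner_apply, conj_trivial, h₁i, h₁j, h₂i, h₂j, hk]
    simp only [Set.mem_ofPred_eq] at hm₁ hm₂
    nlinarith [mul_nonneg hc hm₁, mul_nonneg hc hm₂]

/-- The cubes of the solid: a central cube, and three cubes on either side of it which together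
with the central cube close up to a ring of cubes, neighbours sharing just an edge. -/
def sevenCubes : Finset (ℤ × ℤ × ℤ) :=
  {(0, 0, 0), (0, 1, 1), (0, -1, 1), (0, 0, 2), (0, 1, -1), (0, -1, -1), (0, 0, -2)}

/-- The first coordinates of the corners and edge midpoints of the unit square, starting from
`(1, 1/2)` counterclockwise. -/
noncomputable def squareX (j : ℤ) : ℝ :=
  match (j % 8).toNat with
  | 0 => 1 | 1 => 1 | 2 => 1 / 2 | 3 => 0 | 4 => 0 | 5 => 0 | 6 => 1 / 2 | _ => 1

/-- The second coordinates of the corners and edge midpoints of the unit square, starting from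
`(1, 1/2)` counterclockwise. -/
noncomputable def squareY (j : ℤ) : ℝ :=
  match (j % 8).toNat with
  | 0 => 1 / 2 | 1 => 1 | 2 => 1 | 3 => 1 | 4 => 1 / 2 | 5 => 0 | 6 => 0 | _ => 0

/-- The first coordinates of the points that divide the boundary of `[-1, 2] × [1, 2]` into
segments of length `1/2`, starting from `(1/2, 1)` counterclockwise. -/
noncomputable def rectX (j : ℤ) : ℝ :=
  match (j % 16).toNat with
  | 0 => 1 / 2 | 1 => 1 | 2 => 3 / 2 | 3 => 2 | 4 => 2 | 5 => 2 | 6 => 3 / 2 | 7 => 1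
  | 8 => 1 / 2 | 9 => 0 | 10 => -1 / 2 | 11 => -1 | 12 => -1 | 13 => -1 | 14 => -1 / 2 | _ => 0

/-- The second coordinates of the points that divide the boundary of `[-1, 2] × [1, 2]` into
segments of length `1/2`, starting from `(1/2, 1)` counterclockwise. -/
noncomputable def rectY (j : ℤ) : ℝ :=
  match (j % 16).toNat with
  | 0 => 1 | 1 => 1 | 2 => 1 | 3 => 1 | 4 => 3 / 2 | 5 => 2 | 6 => 2 | 7 => 2
  | 8 => 2 | 9 => 2 | 10 => 2 | 11 => 2 | 12 => 3 / 2 | 13 => 1 | 14 => 1 | _ => 1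

/-- The nodes of the four helices that make up the geodesic, each consisting of `N` segments: up
the central cube, around the upper ring, down the central cube, around the lower ring. -/
noncomputable def helix (N : ℤ) : Fin 4 → ℤ → EuclideanSpace ℝ (Fin 3)
  | 0, j => !₂[squareX j, squareY j, j / N]
  | 1, j => !₂[1 - j / N, rectX j, rectY j]
  | 2, j => !₂[1 - squareX j, squareY j, 1 - j / N]
  | 3, j => !₂[j / N, rectX j, 1 - rectY j]

lemma norm_helix_sub (N : ℤ) (c : Fin 4) (j : ℤ) :
    ‖helix N c (j + 1) - helix N c j‖ = √(1 / 4 + (1 / N : ℝ) ^ 2) := by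
  have h : j % 16 < 16 := Int.emod_lt_of_pos _ (by norm_num)
  have h' : 0 ≤ j % 16 := Int.emod_nonneg _ (by norm_num)
  obtain ⟨r, hr⟩ : ∃ r, j % 16 = r := ⟨_, rfl⟩
  rw [hr] at h h'
  have h1 : (j + 1) % 16 = (r + 1) % 16 := by omega
  have h2 : j % 8 = r % 8 := by omega
  have h3 : (j + 1) % 8 = (r + 1) % 8 := by omega
  rw [EuclideanSpace.norm_eq]
  congr 1
  fin_cases c <;> interval_cases r <;>
    simp [helix, squareX, squareY, rectX, rectY, hr, h1, h2, h3, Fin.sum_univ_three] <;> ring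

lemma exists_cell_square (j : ℤ) :
    ∃ w : ℤ × ℤ, w ∈ ({(1, 0), (0, 1), (-1, 0), (0, -1)} : Finset (ℤ × ℤ)) ∧
      ∀ i ∈ ({j, j + 1} : Set ℤ), (squareX i ∈ Set.Icc 0 1 ∧ squareY i ∈ Set.Icc 0 1) ∧
        squareX i ∈ Set.Icc (w.1 : ℝ) (w.1 + 1) ∧ squareY i ∈ Set.Icc (w.2 : ℝ) (w.2 + 1) := by
  have h : j % 8 < 8 := Int.emod_lt_of_pos _ (by norm_num)
  have h' : 0 ≤ j % 8 := Int.emod_nonneg _ (by norm_num)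
  obtain ⟨r, hr⟩ : ∃ r, j % 8 = r := ⟨_, rfl⟩
  rw [hr] at h h'
  have h1 : (j + 1) % 8 = (r + 1) % 8 := by omega
  simp only [Set.mem_insert_iff, Set.mem_singleton_iff, forall_eq_or_imp, forall_eq]
  interval_cases r
  on_goal 1 => refine ⟨(1, 0), by decide, ?_⟩
  on_goal 2 => refine ⟨(0, 1), by decide, ?_⟩
  on_goal 3 => refine ⟨(0, 1), by decide, ?_⟩
  on_goal 4 => refine ⟨(-1, 0), by decide, ?_⟩
  on_goal 5 => refine ⟨(-1, 0), by decide, ?_⟩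
  on_goal 6 => refine ⟨(0, -1), by decide, ?_⟩
  on_goal 7 => refine ⟨(0, -1), by decide, ?_⟩
  on_goal 8 => refine ⟨(1, 0), by decide, ?_⟩
  all_goals
    simp [squareX, squareY, hr, h1]
    try norm_num

lemma exists_cell_rect (j : ℤ) :
    ∃ v w : ℤ × ℤ, ((0, v.1, v.2) ∈ sevenCubes ∧ (0, v.1, -v.2) ∈ sevenCubes) ∧
      ((0, w.1, w.2) ∉ sevenCubes ∧ (0, w.1, -w.2) ∉ sevenCubes) ∧
      ∀ i ∈ ({j, j + 1} : Set ℤ),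
        (rectX i ∈ Set.Icc (v.1 : ℝ) (v.1 + 1) ∧ rectY i ∈ Set.Icc (v.2 : ℝ) (v.2 + 1)) ∧
        rectX i ∈ Set.Icc (w.1 : ℝ) (w.1 + 1) ∧ rectY i ∈ Set.Icc (w.2 : ℝ) (w.2 + 1) := by
  have h : j % 16 < 16 := Int.emod_lt_of_pos _ (by norm_num)
  have h' : 0 ≤ j % 16 := Int.emod_nonneg _ (by norm_num)
  obtain ⟨r, hr⟩ : ∃ r, j % 16 = r := ⟨_, rfl⟩
  rw [hr] at h h'
  have h1 : (j + 1) % 16 = (r + 1) % 16 := by omega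
  simp only [Set.mem_insert_iff, Set.mem_singleton_iff, forall_eq_or_imp, forall_eq]
  interval_cases r
  on_goal 1 => refine ⟨(0, 0), (0, 1), by decide, by decide, ?_⟩
  on_goal 2 => refine ⟨(1, 1), (1, 0), by decide, by decide, ?_⟩
  on_goal 3 => refine ⟨(1, 1), (1, 0), by decide, by decide, ?_⟩
  on_goal 4 => refine ⟨(1, 1), (2, 1), by decide, by decide, ?_⟩
  on_goal 5 => refine ⟨(1, 1), (2, 1), by decide, by decide, ?_⟩
  on_goal 6 => refine ⟨(1, 1), (1, 2), by decide, by decide, ?_⟩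
  on_goal 7 => refine ⟨(1, 1), (1, 2), by decide, by decide, ?_⟩
  on_goal 8 => refine ⟨(0, 2), (0, 1), by decide, by decide, ?_⟩
  on_goal 9 => refine ⟨(0, 2), (0, 1), by decide, by decide, ?_⟩
  on_goal 10 => refine ⟨(-1, 1), (-1, 2), by decide, by decide, ?_⟩
  on_goal 11 => refine ⟨(-1, 1), (-1, 2), by decide, by decide, ?_⟩
  on_goal 12 => refine ⟨(-1, 1), (-2, 1), by decide, by decide, ?_⟩
  on_goal 13 => refine ⟨(-1, 1), (-2, 1), by decide, by decide, ?_⟩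
  on_goal 14 => refine ⟨(-1, 1), (-1, 0), by decide, by decide, ?_⟩
  on_goal 15 => refine ⟨(-1, 1), (-1, 0), by decide, by decide, ?_⟩
  on_goal 16 => refine ⟨(0, 0), (0, 1), by decide, by decide, ?_⟩
  all_goals
    simp [rectX, rectY, hr, h1]
    try norm_num

lemma intCast_div_mem_Icc {N i : ℤ} (h0 : 0 ≤ i) (hN : i ≤ N) : (i / N : ℝ) ∈ Set.Icc 0 1 := by
  have h0' : (0 : ℝ) ≤ i := by exact_mod_cast h0
  have hN' : (i : ℝ) ≤ N := by exact_mod_cast hN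
  exact ⟨div_nonneg h0' (h0'.trans hN'), div_le_one_of_le₀ hN' (h0'.trans hN')⟩

lemma exists_unitCube_helix {N : ℤ} (c : Fin 4) {j : ℤ} (h0 : 0 ≤ j) (hN : j < N) :
    ∃ v ∈ sevenCubes, ∃ w ∉ sevenCubes, ∀ i ∈ ({j, j + 1} : Set ℤ),
      helix N c i ∈ unitCube v ∩ unitCube w := by
  have hi : ∀ i ∈ ({j, j + 1} : Set ℤ), (i / N : ℝ) ∈ Set.Icc 0 1 := by
    rintro i (rfl | rfl) <;> exact intCast_div_mem_Icc (by omega) (by omega)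
  fin_cases c
  · obtain ⟨w, hw, h⟩ := exists_cell_square j
    refine ⟨(0, 0, 0), by decide, (w.1, w.2, 0), ?_, fun i hij => ?_⟩
    · fin_cases hw <;> decide
    · simpa [unitCube, helix] using ⟨⟨(h i hij).1.1, (h i hij).1.2, hi i hij⟩,
        (h i hij).2.1, (h i hij).2.2, hi i hij⟩
  · obtain ⟨v, w, hv, hw, h⟩ := exists_cell_rect j
    refine ⟨_, hv.1, _, hw.1, fun i hij => ?_⟩
    have := hi i hij
    simpa [unitCube, helix] using ⟨⟨this.symm, (h i hij).1⟩, this.symm, (h i hij).2⟩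
  · obtain ⟨w, hw, h⟩ := exists_cell_square j
    refine ⟨(0, 0, 0), by decide, (-w.1, w.2, 0), ?_, fun i hij => ?_⟩
    · fin_cases hw <;> decide
    · have := hi i hij
      obtain ⟨⟨h1, h2⟩, h3, h4⟩ := h i hij
      refine ⟨⟨?_, ?_, ?_⟩, ?_, ?_, ?_⟩ <;>
        simp only [helix, Fin.isValue, PiLp.toLp_apply, Matrix.cons_val] <;> push_cast <;>
        constructor <;> linarith [this.1, this.2, h1.1, h1.2, h2.1, h2.2, h3.1, h3.2, h4.1, h4.2]
  · obtain ⟨v, w, hv, hw, h⟩ := exists_cell_rect j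
    refine ⟨_, hv.2, _, hw.2, fun i hij => ?_⟩
    have := hi i hij
    obtain ⟨⟨h1, h2⟩, h3, h4⟩ := h i hij
    refine ⟨⟨?_, ?_, ?_⟩, ?_, ?_, ?_⟩ <;>
      simp only [helix, Fin.isValue, PiLp.toLp_apply, Matrix.cons_val] <;> push_cast <;>
      constructor <;> linarith [this.1, this.2, h1.1, h1.2, h2.1, h2.2, h3.1, h3.2, h4.1, h4.2]

set_option maxHeartbeats 1000000 in
lemma isShortestBend_helix {N : ℤ} (c : Fin 4) {j : ℤ} (h0 : 0 < j) (hjN : j < N) :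
    IsShortestBend (⋃ v ∈ sevenCubes, unitCube v) (helix N c j)
      (helix N c j - helix N c (j - 1)) (helix N c (j + 1) - helix N c j) := by
  have hj : (j / N : ℝ) ∈ Set.Ioo 0 1 := by
    have h0' : (0 : ℝ) < j := by exact_mod_cast h0
    have hN' : (j : ℝ) < N := by exact_mod_cast hjN
    exact ⟨div_pos h0' (h0'.trans hN'), (div_lt_one (h0'.trans hN')).2 hN'⟩
  have straight : helix N c j - helix N c (j - 1) = helix N c (j + 1) - helix N c j →
      IsShortestBend (⋃ v ∈ sevenCubes, unitCube v) (helix N c j)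
        (helix N c j - helix N c (j - 1)) (helix N c (j + 1) - helix N c j) := by
    intro h
    rw [h]
    exact isShortestBend_self _ _ _
  fin_cases c
  · have h : j % 8 < 8 := Int.emod_lt_of_pos _ (by norm_num)
    have h' : 0 ≤ j % 8 := Int.emod_nonneg _ (by norm_num)
    obtain ⟨r, hr⟩ : ∃ r, j % 8 = r := ⟨_, rfl⟩
    rw [hr] at h h'
    have h1 : (j + 1) % 8 = (r + 1) % 8 := by omega
    have h1' : (j - 1) % 8 = (r - 1) % 8 := by omega
    interval_cases r
    on_goal 8 =>
      refine isShortestBend_of_edge (S := sevenCubes) (0, 0, 0) 1 0 2 (-1) 1 (1 / 2)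
        (by norm_num) ?_ ?_ ?_ ?_ ?_ ?_ ?_ ?_
    on_goal 6 =>
      refine isShortestBend_of_edge (S := sevenCubes) (0, 0, 0) 0 1 2 (-1) (-1) (1 / 2)
        (by norm_num) ?_ ?_ ?_ ?_ ?_ ?_ ?_ ?_
    on_goal 4 =>
      refine isShortestBend_of_edge (S := sevenCubes) (0, 0, 0) 1 0 2 1 (-1) (1 / 2)
        (by norm_num) ?_ ?_ ?_ ?_ ?_ ?_ ?_ ?_
    on_goal 2 =>
      refine isShortestBend_of_edge (S := sevenCubes) (0, 0, 0) 0 1 2 1 1 (1 / 2)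
        (by norm_num) ?_ ?_ ?_ ?_ ?_ ?_ ?_ ?_
    all_goals first
      | refine straight ?_
        ext l
        fin_cases l <;> simp [helix, squareX, squareY, hr, h1, h1'] <;> ring
      | simp [helix, squareX, squareY, corner, hr, h1, h1', hj.1, hj.2]
        try ring
  · have h : j % 16 < 16 := Int.emod_lt_of_pos _ (by norm_num)
    have h' : 0 ≤ j % 16 := Int.emod_nonneg _ (by norm_num)
    obtain ⟨r, hr⟩ : ∃ r, j % 16 = r := ⟨_, rfl⟩
    rw [hr] at h h'
    have h1 : (j + 1) % 16 = (r + 1) % 16 := by omega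
    have h1' : (j - 1) % 16 = (r - 1) % 16 := by omega
    interval_cases r
    on_goal 14 =>
      refine isShortestBend_of_edge (S := sevenCubes) (0, -1, 1) 1 2 0 (-1) (-1) (1 / 2)
        (by norm_num) ?_ ?_ ?_ ?_ ?_ ?_ ?_ ?_
    on_goal 12 =>
      refine isShortestBend_of_edge (S := sevenCubes) (0, -1, 1) 2 1 0 1 (-1) (1 / 2)
        (by norm_num) ?_ ?_ ?_ ?_ ?_ ?_ ?_ ?_
    on_goal 6 =>
      refine isShortestBend_of_edge (S := sevenCubes) (0, 1, 1) 1 2 0 1 1 (1 / 2)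
        (by norm_num) ?_ ?_ ?_ ?_ ?_ ?_ ?_ ?_
    on_goal 4 =>
      refine isShortestBend_of_edge (S := sevenCubes) (0, 1, 1) 2 1 0 (-1) 1 (1 / 2)
        (by norm_num) ?_ ?_ ?_ ?_ ?_ ?_ ?_ ?_
    all_goals first
      | refine straight ?_
        ext l
        fin_cases l <;> simp [helix, rectX, rectY, hr, h1, h1'] <;> ring
      | simp [helix, rectX, rectY, corner, hr, h1, h1', hj.1, hj.2]
        try ring
  · have h : j % 8 < 8 := Int.emod_lt_of_pos _ (by norm_num)
    have h' : 0 ≤ j % 8 := Int.emod_nonneg _ (by norm_num)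
    obtain ⟨r, hr⟩ : ∃ r, j % 8 = r := ⟨_, rfl⟩
    rw [hr] at h h'
    have h1 : (j + 1) % 8 = (r + 1) % 8 := by omega
    have h1' : (j - 1) % 8 = (r - 1) % 8 := by omega
    interval_cases r
    on_goal 8 =>
      refine isShortestBend_of_edge (S := sevenCubes) (0, 0, 0) 1 0 2 (-1) (-1) (1 / 2)
        (by norm_num) ?_ ?_ ?_ ?_ ?_ ?_ ?_ ?_
    on_goal 6 =>
      refine isShortestBend_of_edge (S := sevenCubes) (0, 0, 0) 0 1 2 1 (-1) (1 / 2)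
        (by norm_num) ?_ ?_ ?_ ?_ ?_ ?_ ?_ ?_
    on_goal 4 =>
      refine isShortestBend_of_edge (S := sevenCubes) (0, 0, 0) 1 0 2 1 1 (1 / 2)
        (by norm_num) ?_ ?_ ?_ ?_ ?_ ?_ ?_ ?_
    on_goal 2 =>
      refine isShortestBend_of_edge (S := sevenCubes) (0, 0, 0) 0 1 2 (-1) 1 (1 / 2)
        (by norm_num) ?_ ?_ ?_ ?_ ?_ ?_ ?_ ?_
    all_goals first
      | refine straight ?_
        ext l
        fin_cases l <;> simp [helix, squareX, squareY, hr, h1, h1'] <;> ring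
      | simp [helix, squareX, squareY, corner, hr, h1, h1', hj.1, hj.2]
        try ring
  · have h : j % 16 < 16 := Int.emod_lt_of_pos _ (by norm_num)
    have h' : 0 ≤ j % 16 := Int.emod_nonneg _ (by norm_num)
    obtain ⟨r, hr⟩ : ∃ r, j % 16 = r := ⟨_, rfl⟩
    rw [hr] at h h'
    have h1 : (j + 1) % 16 = (r + 1) % 16 := by omega
    have h1' : (j - 1) % 16 = (r - 1) % 16 := by omega
    interval_cases r
    on_goal 14 =>
      refine isShortestBend_of_edge (S := sevenCubes) (0, -1, -1) 1 2 0 (-1) 1 (1 / 2)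
        (by norm_num) ?_ ?_ ?_ ?_ ?_ ?_ ?_ ?_
    on_goal 12 =>
      refine isShortestBend_of_edge (S := sevenCubes) (0, -1, -1) 2 1 0 (-1) (-1) (1 / 2)
        (by norm_num) ?_ ?_ ?_ ?_ ?_ ?_ ?_ ?_
    on_goal 6 =>
      refine isShortestBend_of_edge (S := sevenCubes) (0, 1, -1) 1 2 0 1 (-1) (1 / 2)
        (by norm_num) ?_ ?_ ?_ ?_ ?_ ?_ ?_ ?_
    on_goal 4 =>
      refine isShortestBend_of_edge (S := sevenCubes) (0, 1, -1) 2 1 0 1 1 (1 / 2)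
        (by norm_num) ?_ ?_ ?_ ?_ ?_ ?_ ?_ ?_
    all_goals first
      | refine straight ?_
        ext l
        fin_cases l <;> simp [helix, rectX, rectY, hr, h1, h1'] <;> ring
      | simp [helix, rectX, rectY, corner, hr, h1, h1', hj.1, hj.2]
        try ring


lemma helix_end {N : ℤ} (hN : 0 < N) (h16 : 16 ∣ N) (c : Fin 4) :
    helix N c N = helix N (c + 1) 0 := by
  have h1 : N % 16 = 0 := by omega
  have h2 : N % 8 = 0 := by omega
  have h3 : (N : ℝ) ≠ 0 := by exact_mod_cast hN.ne'
  ext l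
  fin_cases c <;> fin_cases l <;>
    simp [helix, squareX, squareY, rectX, rectY, h1, h2, h3, show (3 : Fin 4) + 1 = 0 from rfl,
      show (2 : Fin 4) + 1 = 3 from rfl, show (1 : Fin 4) + 1 = 2 from rfl]

lemma isShortestBend_helix_end {N : ℤ} (hN : 0 < N) (h16 : 16 ∣ N) (c : Fin 4) :
    IsShortestBend (⋃ v ∈ sevenCubes, unitCube v) (helix N (c + 1) 0)
      (helix N c N - helix N c (N - 1)) (helix N (c + 1) 1 - helix N (c + 1) 0) := by
  have h1 : N % 16 = 0 := by omega
  have h2 : N % 8 = 0 := by omega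
  have h1' : (N - 1) % 16 = 15 := by omega
  have h2' : (N - 1) % 8 = 7 := by omega
  have h3 : (N : ℝ) ≠ 0 := by exact_mod_cast hN.ne'
  have h4 : (0 : ℝ) ≤ 1 / N := by
    have : (0 : ℝ) < N := by exact_mod_cast hN
    positivity
  fin_cases c
  · refine isShortestBend_of_edge (S := sevenCubes) (0, 0, 0) 0 2 1 1 1 (1 / N) h4
      ?_ ?_ ?_ ?_ ?_ ?_ ?_ ?_
    all_goals
      simp [helix, squareX, squareY, rectX, rectY, corner, h2, h2']
      try field_simp
      try norm_num
  · refine isShortestBend_of_edge (S := sevenCubes) (0, 0, 0) 2 0 1 1 (-1) (1 / N) h4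
      ?_ ?_ ?_ ?_ ?_ ?_ ?_ ?_
    all_goals
      simp [helix, squareX, squareY, rectX, rectY, corner, h1, h1',
        show (1 : Fin 4) + 1 = 2 from rfl]
      try field_simp
      try norm_num
  · refine isShortestBend_of_edge (S := sevenCubes) (0, 0, 0) 0 2 1 (-1) (-1) (1 / N) h4
      ?_ ?_ ?_ ?_ ?_ ?_ ?_ ?_
    all_goals
      simp [helix, squareX, squareY, rectX, rectY, corner, h2, h2',
        show (2 : Fin 4) + 1 = 3 from rfl]
      try field_simp
      try norm_num
  · refine isShortestBend_of_edge (S := sevenCubes) (0, 0, 0) 2 0 1 (-1) 1 (1 / N) h4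
      ?_ ?_ ?_ ?_ ?_ ?_ ?_ ?_
    all_goals
      simp [helix, squareX, squareY, rectX, rectY, corner, h1, h1',
        show (3 : Fin 4) + 1 = 0 from rfl]
      try field_simp
      try norm_num

/-- The helix that the nodes `N * q, …, N * q + N` of the geodesic belong to. -/
def helixIndex (q : ℤ) : Fin 4 := Fin.ofNat 4 (q % 4).toNat

lemma helixIndex_add_one (q : ℤ) : helixIndex (q + 1) = helixIndex q + 1 := by
  have h : q % 4 < 4 := Int.emod_lt_of_pos _ (by norm_num)
  have h' : 0 ≤ q % 4 := Int.emod_nonneg _ (by norm_num)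
  obtain ⟨r, hr⟩ : ∃ r, q % 4 = r := ⟨_, rfl⟩
  rw [hr] at h h'
  have h1 : (q + 1) % 4 = (r + 1) % 4 := by omega
  rw [helixIndex, helixIndex, hr, h1]
  interval_cases r <;> rfl

/-- The nodes of the geodesic: the four helices, one after the other. -/
noncomputable def track (N k : ℤ) : EuclideanSpace ℝ (Fin 3) :=
  helix N (helixIndex (k / N)) (k % N)

lemma track_periodic {N : ℤ} (hN : 0 < N) : Function.Periodic (track N) (4 * N) := by
  intro k
  have h : (k / N + 4) % 4 = k / N % 4 := by omega
  simp [track, Int.add_mul_ediv_right _ _ hN.ne', helixIndex, h]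

lemma track_mul_add {N : ℤ} (hN : 0 < N) (h16 : 16 ∣ N) (q : ℤ) {j : ℤ} (hj : 0 ≤ j)
    (hjN : j ≤ N) : track N (N * q + j) = helix N (helixIndex q) j := by
  have key : ∀ q j : ℤ, 0 ≤ j → j < N → track N (N * q + j) = helix N (helixIndex q) j := by
    intro q j hj hjN
    rw [track, Int.mul_add_emod_self_left, Int.emod_eq_of_lt hj hjN, add_comm,
      Int.add_mul_ediv_left _ _ hN.ne', Int.ediv_eq_zero_of_lt hj hjN, zero_add]
  rcases hjN.lt_or_eq with h | rfl
  · exact key q j hj h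
  · have := key (q + 1) 0 le_rfl hN
    rw [helixIndex_add_one, ← helix_end hN h16, add_zero, mul_add, mul_one] at this
    exact this

lemma isShortestBend_track {N : ℤ} (hN : 0 < N) (h16 : 16 ∣ N) (k : ℤ) :
    IsShortestBend (⋃ v ∈ sevenCubes, unitCube v) (track N k)
      (track N k - track N (k - 1)) (track N (k + 1) - track N k) := by
  have h0 := Int.emod_nonneg k hN.ne'
  have h1 := Int.emod_lt_of_pos k hN
  have hk := Int.mul_ediv_add_emod k N
  set q := k / N
  set j := k % N
  have e1 : k + 1 = N * q + (j + 1) := by omega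
  rcases h0.eq_or_lt with h | h
  · obtain ⟨q', hq'⟩ : ∃ q', q = q' + 1 := ⟨q - 1, by ring⟩
    have e2 : k - 1 = N * q' + (N - 1) := by rw [← hk, ← h, hq']; ring
    have e3 : track N k = helix N (helixIndex q') N := by
      rw [← track_mul_add hN h16 _ hN.le le_rfl, ← hk, ← h, hq']
      ring_nf
    have := isShortestBend_helix_end hN h16 (helixIndex q')
    rw [← helix_end hN h16] at this
    rw [e1, track_mul_add hN h16 q (by omega) (by omega), e2,
      track_mul_add hN h16 q' (by omega) (by omega), e3, hq', helixIndex_add_one, ← h, zero_add]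
    exact this
  · have e2 : k - 1 = N * q + (j - 1) := by omega
    rw [e1, track_mul_add hN h16 q (by omega) (by omega), e2,
      track_mul_add hN h16 q (by omega) (by omega), ← hk, track_mul_add hN h16 q h0 h1.le]
    exact isShortestBend_helix _ h h1

lemma exists_track_eq_helix {N : ℤ} (hN : 0 < N) (h16 : 16 ∣ N) (k : ℤ) :
    ∃ c j, 0 ≤ j ∧ j < N ∧ track N k = helix N c j ∧ track N (k + 1) = helix N c (j + 1) := by
  have h0 := Int.emod_nonneg k hN.ne'
  have h1 := Int.emod_lt_of_pos k hN
  have hk := Int.mul_ediv_add_emod k N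
  have e1 : k + 1 = N * (k / N) + (k % N + 1) := by omega
  refine ⟨helixIndex (k / N), k % N, h0, h1, rfl, ?_⟩
  rw [e1, track_mul_add hN h16 _ (by omega) (by omega)]

lemma norm_track_sub {N : ℤ} (hN : 0 < N) (h16 : 16 ∣ N) (k : ℤ) :
    ‖track N (k + 1) - track N k‖ = √(1 / 4 + (1 / N : ℝ) ^ 2) := by
  obtain ⟨c, j, -, -, h, h'⟩ := exists_track_eq_helix hN h16 k
  rw [h, h', norm_helix_sub]

lemma polygonal_track_mem_frontier {N : ℤ} (hN : 0 < N) (h16 : 16 ∣ N) (t : ℝ) :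
    polygonal (track N) t ∈ frontier (⋃ v ∈ sevenCubes, unitCube v) := by
  obtain ⟨c, j, hj, hjN, h, h'⟩ := exists_track_eq_helix hN h16 ⌊t⌋
  obtain ⟨v, hv, w, hw, hvw⟩ := exists_unitCube_helix c hj hjN
  rw [polygonal, h, h']
  have h0 := hvw j (by simp)
  have h1 := hvw (j + 1) (by simp)
  have ha : Int.fract t ∈ Set.Icc (0 : ℝ) 1 := ⟨Int.fract_nonneg t, (Int.fract_lt_one t).le⟩
  exact mem_frontier_of_mem_unitCube hv hw
    ((convex_unitCube v).add_smul_sub_mem h0.1 h1.1 ha)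
    ((convex_unitCube w).add_smul_sub_mem h0.2 h1.2 ha)

lemma polygonal_track_locally_shortest {N : ℤ} (hN : 0 < N) (h16 : 16 ∣ N) {n : ℝ} (hn : 0 < n)
    (t : ℝ) : ∃ ε > (0 : ℝ), ∀ s₁ s₂ : ℝ,
      s₁ ∈ Set.Ioo (t - ε) (t + ε) → s₂ ∈ Set.Ioo (t - ε) (t + ε) → s₁ ≤ s₂ →
      ∀ (a b : ℝ) (c : ℝ → EuclideanSpace ℝ (Fin 3)), a ≤ b → ContinuousOn c (Set.Icc a b) →
        c a = polygonal (track N) (n * s₁) → c b = polygonal (track N) (n * s₂) →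
        (∀ x ∈ Set.Icc a b, c x ∉ interior (⋃ v ∈ sevenCubes, unitCube v)) →
        eVariationOn (fun s => polygonal (track N) (n * s)) (Set.Icc s₁ s₂) ≤
          eVariationOn c (Set.Icc a b) := by
  rcases (Int.floor_le (n * t)).eq_or_lt with h | h
  · refine IsShortestBend.locally_shortest ?_
      (HasVelocities.comp_mul hn (h ▸ hasVelocities_polygonal_intCast (track N) ⌊n * t⌋))
    nth_rw 1 [← h]
    rw [polygonal_intCast]
    exact (isShortestBend_track hN h16 _).smul hn.le
  · exact IsShortestBend.locally_shortest (isShortestBend_self _ _ _)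
      (HasVelocities.comp_mul hn (hasVelocities_polygonal _ ⟨h, Int.lt_floor_add_one _⟩))

lemma polygonal_apply (p : ℤ → EuclideanSpace ℝ (Fin 3)) (t : ℝ) (l : Fin 3) :
    polygonal p t l = polygonal (fun k => p k l) t := by
  simp [polygonal]

lemma polygonal_intCast_div (N : ℤ) (t : ℝ) : polygonal (fun k => (k / N : ℝ)) t = t / N := by
  simp only [polygonal, smul_eq_mul, Int.fract]
  push_cast
  ring

lemma polygonal_one_sub (p : ℤ → ℝ) (t : ℝ) :
    polygonal (fun k => 1 - p k) t = 1 - polygonal p t := by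
  simp only [polygonal, smul_eq_mul]
  ring

lemma squareX_neg (j : ℤ) : squareX (-j) = squareX j := by
  have h : j % 8 < 8 := Int.emod_lt_of_pos _ (by norm_num)
  have h' : 0 ≤ j % 8 := Int.emod_nonneg _ (by norm_num)
  obtain ⟨r, hr⟩ : ∃ r, j % 8 = r := ⟨_, rfl⟩
  rw [hr] at h h'
  have h1 : (-j) % 8 = (-r) % 8 := by omega
  interval_cases r <;> simp [squareX, hr, h1]

lemma squareY_neg (j : ℤ) : squareY (-j) = 1 - squareY j := by
  have h : j % 8 < 8 := Int.emod_lt_of_pos _ (by norm_num)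
  have h' : 0 ≤ j % 8 := Int.emod_nonneg _ (by norm_num)
  obtain ⟨r, hr⟩ : ∃ r, j % 8 = r := ⟨_, rfl⟩
  rw [hr] at h h'
  have h1 : (-j) % 8 = (-r) % 8 := by omega
  interval_cases r <;> simp [squareY, hr, h1] <;> norm_num

lemma polygonal_square_ne_center (t : ℝ) :
    ¬ (polygonal squareX t = 1 / 2 ∧ polygonal squareY t = 1 / 2) := by
  rintro ⟨hX, hY⟩
  obtain ⟨w, hw, h⟩ := exists_cell_square ⌊t⌋
  have h1 := polygonal_mem (convex_Icc _ _) fun i hi => (h i hi).2.1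
  have h2 := polygonal_mem (convex_Icc _ _) fun i hi => (h i hi).2.2
  rw [hX] at h1
  rw [hY] at h2
  fin_cases hw <;> first | (norm_num at h1; done) | norm_num at h2

lemma one_le_polygonal_rectY (t : ℝ) : 1 ≤ polygonal rectY t := by
  change polygonal rectY t ∈ Set.Ici 1
  refine polygonal_mem (convex_Ici 1) fun i _ => ?_
  simp only [rectY, Set.mem_Ici]
  split <;> norm_num

lemma polygonal_helix (N : ℤ) (c : Fin 4) (t : ℝ) : polygonal (helix N c) t =
    match c with
    | 0 => !₂[polygonal squareX t, polygonal squareY t, t / N]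
    | 1 => !₂[1 - t / N, polygonal rectX t, polygonal rectY t]
    | 2 => !₂[1 - polygonal squareX t, polygonal squareY t, 1 - t / N]
    | 3 => !₂[t / N, polygonal rectX t, 1 - polygonal rectY t] := by
  ext l
  fin_cases c <;> fin_cases l <;>
    simp [polygonal_apply, helix, polygonal_intCast_div, polygonal_one_sub]

lemma squareX_periodic {N : ℤ} (h16 : 16 ∣ N) : Function.Periodic squareX N := fun j => by
  have : (j + N) % 8 = j % 8 := by omega
  rw [squareX, squareX, this]

lemma squareY_periodic {N : ℤ} (h16 : 16 ∣ N) : Function.Periodic squareY N := fun j => by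
  have : (j + N) % 8 = j % 8 := by omega
  rw [squareY, squareY, this]

lemma polygonal_helix_ne {N : ℤ} (hN : 0 < N) (h16 : 16 ∣ N) {c c' : Fin 4} (hc : c < c')
    {w w' : ℝ} (hw : w ∈ Set.Ico (0 : ℝ) N) (hw' : w' ∈ Set.Ico (0 : ℝ) N) :
    polygonal (helix N c) w ≠ polygonal (helix N c') w' := by
  intro h
  have hN' : (0 : ℝ) < N := by exact_mod_cast hN
  have u0 : 0 ≤ w / N := div_nonneg hw.1 hN'.le
  have u0' : 0 ≤ w' / N := div_nonneg hw'.1 hN'.le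
  have u1 : w / N < 1 := (div_lt_one hN').2 hw.2
  have u1' : w' / N < 1 := (div_lt_one hN').2 hw'.2
  have r := one_le_polygonal_rectY w
  have r' := one_le_polygonal_rectY w'
  have X0 : polygonal squareX 0 = 1 := by simp [polygonal, squareX]
  have hzero : ∀ {x : ℝ}, x / N ≤ 0 → 0 ≤ x → x = 0 := fun {x} hx hx0 =>
    le_antisymm (by simpa using (div_le_iff₀ hN').1 hx) hx0
  rw [polygonal_helix, polygonal_helix] at h
  have e0 := congrArg (fun x : EuclideanSpace ℝ (Fin 3) => x 0) h
  have e1 := congrArg (fun x : EuclideanSpace ℝ (Fin 3) => x 1) h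
  have e2 := congrArg (fun x : EuclideanSpace ℝ (Fin 3) => x 2) h
  clear h
  fin_cases c <;> fin_cases c' <;> simp at hc e0 e1 e2
  · linarith
  · have h : w' = -w + N := by
      field_simp at e2
      linarith
    rw [h, polygonal_add_intCast (squareX_periodic h16), polygonal_neg] at e0
    rw [h, polygonal_add_intCast (squareY_periodic h16), polygonal_neg] at e1
    simp only [squareX_neg, squareY_neg, polygonal_one_sub] at e0 e1
    exact polygonal_square_ne_center w ⟨by linarith, by linarith⟩
  · rw [hzero (by linarith) hw.1, X0] at e0
    linarith
  · rw [hzero (x := w') (by linarith) hw'.1, X0] at e0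
    linarith
  · linarith
  · linarith

lemma polygonal_helix_injective {N : ℤ} (hN : 0 < N) (c : Fin 4) :
    Function.Injective (polygonal (helix N c)) := by
  intro w w' h
  have hN' : (N : ℝ) ≠ 0 := by exact_mod_cast hN.ne'
  rw [polygonal_helix, polygonal_helix] at h
  have e0 := congrArg (fun x : EuclideanSpace ℝ (Fin 3) => x 0) h
  have e2 := congrArg (fun x : EuclideanSpace ℝ (Fin 3) => x 2) h
  fin_cases c
  · simpa [hN'] using e2
  · simpa [hN'] using e0
  · simpa [hN'] using e2
  · simpa [hN'] using e0

lemma polygonal_track_eq {N : ℤ} (hN : 0 < N) (h16 : 16 ∣ N) {t : ℝ}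
    (ht : t ∈ Set.Ico (0 : ℝ) (4 * N)) : ∃ c : Fin 4, ∃ w ∈ Set.Ico (0 : ℝ) N,
      t = N * (c : ℕ) + w ∧ polygonal (track N) t = polygonal (helix N c) w := by
  have hk0 : 0 ≤ ⌊t⌋ := Int.floor_nonneg.2 ht.1
  have hk1 : ⌊t⌋ < 4 * N := Int.floor_lt.2 (by exact_mod_cast ht.2)
  have h0 := Int.emod_nonneg ⌊t⌋ hN.ne'
  have h1 := Int.emod_lt_of_pos ⌊t⌋ hN
  have hk := Int.mul_ediv_add_emod ⌊t⌋ N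
  have hq0 : 0 ≤ ⌊t⌋ / N := Int.ediv_nonneg hk0 hN.le
  have hq1 : ⌊t⌋ / N < 4 := Int.ediv_lt_of_lt_mul hN hk1
  set q := ⌊t⌋ / N
  set j := ⌊t⌋ % N
  have hc : (((helixIndex q : Fin 4) : ℕ) : ℤ) = q := by
    interval_cases q <;> rfl
  have hfl : ((⌊t⌋ : ℤ) : ℝ) = N * q + j := by exact_mod_cast hk.symm
  have hw : t - N * q ∈ Set.Icc (j : ℝ) (j + 1) :=
    ⟨by linarith [Int.floor_le t], by linarith [Int.lt_floor_add_one t]⟩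
  refine ⟨helixIndex q, t - N * q, ⟨?_, ?_⟩, ?_, ?_⟩
  · have : (0 : ℝ) ≤ j := by exact_mod_cast h0
    linarith [hw.1]
  · have : (j + 1 : ℝ) ≤ N := by exact_mod_cast h1
    linarith [Int.lt_floor_add_one t]
  · have : (((helixIndex q : Fin 4) : ℕ) : ℝ) = q := by exact_mod_cast hc
    rw [this]
    ring
  · have e1 : ⌊t⌋ + 1 = N * q + (j + 1) := by omega
    rw [polygonal_of_mem_Icc _ hw, polygonal, e1, track_mul_add hN h16 q (by omega) (by omega),
      ← hk, track_mul_add hN h16 q h0 h1.le, Int.fract, hfl]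
    congr 2
    ring

lemma injOn_polygonal_track {N : ℤ} (hN : 0 < N) (h16 : 16 ∣ N) :
    Set.InjOn (polygonal (track N)) (Set.Ico 0 (4 * N)) := by
  intro s hs t ht hst
  obtain ⟨c, w, hw, hs', e⟩ := polygonal_track_eq hN h16 hs
  obtain ⟨c', w', hw', ht', e'⟩ := polygonal_track_eq hN h16 ht
  rw [e, e'] at hst
  rcases lt_trichotomy c c' with h | rfl | h
  · exact absurd hst (polygonal_helix_ne hN h16 h hw hw')
  · rw [hs', ht', polygonal_helix_injective hN c hst]
  · exact absurd hst.symm (polygonal_helix_ne hN h16 h hw' hw)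

end Cubes

/-- There is a non-convex polyhedron, a union of seven equal unit cubes, whose
surface carries arbitrarily long simple closed curves that are strong geodesics:
locally shortest among all paths avoiding the interior of the solid. -/
theorem seven_cubes_long_strong_geodesics :
    ∃ S : Finset (ℤ × ℤ × ℤ), S.card = 7 ∧
      ∀ L : ℝ, ∃ γ : ℝ → EuclideanSpace ℝ (Fin 3),
        Continuous γ ∧
        Function.Periodic γ 1 ∧
        Set.InjOn γ (Set.Ico (0 : ℝ) 1) ∧
        (∀ t : ℝ, γ t ∈ frontier (⋃ v ∈ S, unitCube v)) ∧
        ENNReal.ofReal L < eVariationOn γ (Set.Icc 0 1) ∧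
        eVariationOn γ (Set.Icc 0 1) ≠ ⊤ ∧
        (∀ t : ℝ, ∃ ε > (0 : ℝ), ∀ s₁ s₂ : ℝ,
          s₁ ∈ Set.Ioo (t - ε) (t + ε) → s₂ ∈ Set.Ioo (t - ε) (t + ε) → s₁ ≤ s₂ →
          ∀ (a b : ℝ) (c : ℝ → EuclideanSpace ℝ (Fin 3)), a ≤ b →
            ContinuousOn c (Set.Icc a b) → c a = γ s₁ → c b = γ s₂ →
            (∀ x ∈ Set.Icc a b, c x ∉ interior (⋃ v ∈ S, unitCube v)) →
            eVariationOn γ (Set.Icc s₁ s₂) ≤ eVariationOn c (Set.Icc a b)) := by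
  refine ⟨sevenCubes, rfl, fun L => ?_⟩
  obtain ⟨M, hM⟩ := exists_nat_gt L
  have hN : (0 : ℤ) < 16 * (M + 1) := by positivity
  have h16 : (16 : ℤ) ∣ 16 * (M + 1) := dvd_mul_right _ _
  have hn : (((64 * (M + 1) : ℕ)) : ℝ) = 4 * ((16 * (M + 1) : ℤ) : ℝ) := by
    push_cast
    ring
  generalize hNdef : (16 * (M + 1) : ℤ) = N at hN h16 hn
  have hn0 : (0 : ℝ) < (64 * (M + 1) : ℕ) := by positivity
  have hv := eVariationOn_comp_natCast_mul (polygonal (track N)) (64 * (M + 1))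
  have hper := fun t : ℝ => polygonal_add_intCast (track_periodic hN) t
  have hℓ : (1 / 2 : ℝ) ≤ √(1 / 4 + (1 / N : ℝ) ^ 2) :=
    Real.le_sqrt_of_sq_le (by linarith [sq_nonneg (1 / N : ℝ)])
  refine ⟨fun t => polygonal (track N) ((64 * (M + 1) : ℕ) * t),
    (continuous_polygonal _).comp (by fun_prop), fun t => ?_, fun s hs t ht hst => ?_,
    fun t => polygonal_track_mem_frontier hN h16 _, ?_, ?_,
    fun t => polygonal_track_locally_shortest hN h16 hn0 t⟩
  · dsimp only
    rw [mul_add, mul_one, hn]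
    exact_mod_cast hper _
  · refine mul_left_cancel₀ hn0.ne' (injOn_polygonal_track hN h16 ?_ ?_ hst)
    all_goals
      rw [← hn]
      constructor <;> nlinarith [hs.1, hs.2, ht.1, ht.2]
  · rw [hv]
    refine lt_of_lt_of_le ?_ (ofReal_le_eVariationOn_polygonal (by norm_num : (0 : ℝ) ≤ 1 / 2)
      (fun k => hℓ.trans_eq (norm_track_sub hN h16 k).symm) _)
    rw [ENNReal.ofReal_lt_ofReal_iff (by positivity)]
    push_cast
    linarith [(M.cast_nonneg : (0 : ℝ) ≤ M)]
  · rw [hv]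
    exact eVariationOn_polygonal_ne_top _ _
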